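/- Let A ∈ 𝓑, let A_n := {x ∈ X : u_n(x;A) = 1}, and let A_∞ := ∩_{n∈ℕ} A_n. Then A_∞ = {x ∈ X : u(x;A) = 1}, the set A_∞ is absorbing, and every absorbing measurable subset of A is contained in A_∞ (so A_∞ is the largest absorbing subset of A). In particular, if m(A) < ∞ then A is simple. -/

import Mathlib

open MeasureTheory ProbabilityTheory

variable {X : Type*} [MeasurableSpace X]

/-- Transition operator: `(Pf)(x) = ∫ f(y) P(x,dy)`. -/
noncomputable def transOp (P : Kernel X X) (f : X → ℝ) : X → ℝ :=
  fun x => ∫ y, f y ∂(P x)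

/-- Invariance operator `I_A f = 1_A · (Pf)`. -/
noncomputable def invOp (P : Kernel X X) (A : Set X) (f : X → ℝ) : X → ℝ :=
  A.indicator (transOp P f)

/-- Invariance value functions `u_n(·;A)`. -/
noncomputable def uN (P : Kernel X X) (A : Set X) : ℕ → X → ℝ
  | 0 => A.indicator 1
  | n + 1 => invOp P A (uN P A n)

/-- `u(x;A) = lim_n u_n(x;A)` (the sequence is pointwise nonincreasing). -/
noncomputable def uFun (P : Kernel X X) (A : Set X) : X → ℝ :=
  fun x => ⨅ n, uN P A n x

/-- Reach-avoid value functions `w_n(·;A,B)`. -/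
noncomputable def wN (P : Kernel X X) (A B : Set X) : ℕ → X → ℝ
  | 0 => B.indicator 1
  | n + 1 => fun x => B.indicator 1 x + invOp P (A \ B) (wN P A B n) x

/-- `w(x;A,B) = lim_n w_n(x;A,B)` (the sequence is pointwise nondecreasing, in `[0,1]`). -/
noncomputable def wFun (P : Kernel X X) (A B : Set X) : X → ℝ :=
  fun x => ⨆ n, wN P A B n x

/-- A bounded function. -/
def BddFun (f : X → ℝ) : Prop := ∃ C : ℝ, ∀ x, |f x| ≤ C

/-- A set `S` is absorbing if `P(x,S) = 1` for all `x ∈ S`. -/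
def Absorbing (P : Kernel X X) (S : Set X) : Prop := ∀ x ∈ S, P x S = 1

/-- A set is simple if its only absorbing measurable subset is empty. -/
def Simple (P : Kernel X X) (A : Set X) : Prop :=
  ∀ S ⊆ A, MeasurableSet S → Absorbing P S → S = ∅

theorem uN_mem_Icc (P : Kernel X X) [IsMarkovKernel P] (A : Set X) (n : ℕ) (x : X) :
    uN P A n x ∈ Set.Icc (0 : ℝ) 1 := by
  induction n generalizing x with
  | zero => by_cases hx : x ∈ A <;> simp [uN, hx]
  | succ n ih =>
    by_cases hx : x ∈ A
    · simp only [uN, invOp, Set.indicator_of_mem hx, transOp]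
      refine ⟨integral_nonneg fun y => (ih y).1, ?_⟩
      calc ∫ y, uN P A n y ∂(P x) ≤ ∫ _, (1 : ℝ) ∂(P x) :=
            integral_mono_of_nonneg (.of_forall fun y => (ih y).1) (integrable_const 1)
              (.of_forall fun y => (ih y).2)
        _ = 1 := by simp
    · simp [uN, invOp, hx]

theorem measurable_uN (P : Kernel X X) [IsMarkovKernel P] {A : Set X} (hA : MeasurableSet A)
    (n : ℕ) : Measurable (uN P A n) := by
  induction n with
  | zero => exact measurable_one.indicator hA
  | succ n ih =>
    exact (ih.stronglyMeasurable.integral_kernel (κ := P)).measurable.indicator hA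

theorem integrable_uN (P : Kernel X X) [IsMarkovKernel P] {A : Set X} (hA : MeasurableSet A)
    (n : ℕ) (x : X) : Integrable (uN P A n) (P x) :=
  .of_mem_Icc 0 1 (measurable_uN P hA n).aemeasurable (.of_forall (uN_mem_Icc P A n))

theorem ae_uN_eq_one_of_uN_succ_eq_one (P : Kernel X X) [IsMarkovKernel P] {A : Set X}
    (hA : MeasurableSet A) {n : ℕ} {x : X} (h : uN P A (n + 1) x = 1) :
    ∀ᵐ y ∂(P x), uN P A n y = 1 := by
  have hx : x ∈ A := by
    by_contra hx
    simp [uN, invOp, hx] at h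
  simp only [uN, invOp, Set.indicator_of_mem hx, transOp] at h
  refine (integral_eq_iff_of_ae_le (integrable_uN P hA n x) (integrable_const 1)
    (.of_forall fun y => (uN_mem_Icc P A n y).2)).1 ?_
  simpa using h

theorem uN_eq_one_of_absorbing (P : Kernel X X) [IsMarkovKernel P] {A S : Set X} (hSA : S ⊆ A)
    (hS : MeasurableSet S) (habs : Absorbing P S) (n : ℕ) {x : X} (hx : x ∈ S) :
    uN P A n x = 1 := by
  induction n generalizing x with
  | zero => simp [uN, hSA hx]
  | succ n ih =>
    simp only [uN, invOp, Set.indicator_of_mem (hSA hx), transOp]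
    have hae : ∀ᵐ y ∂(P x), y ∈ S := (mem_ae_iff_prob_eq_one hS).2 (habs x hx)
    rw [integral_congr_ae (g := fun _ => (1 : ℝ)) (hae.mono fun y hy => ih hy)]
    simp

theorem uFun_eq_one_iff (P : Kernel X X) [IsMarkovKernel P] (A : Set X) (x : X) :
    uFun P A x = 1 ↔ ∀ n, uN P A n x = 1 := by
  refine ⟨fun h n => le_antisymm (uN_mem_Icc P A n x).2 ?_, fun h => by simp [uFun, h]⟩
  rw [← h]
  exact ciInf_le ⟨0, Set.forall_mem_range.2 fun n => (uN_mem_Icc P A n x).1⟩ n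

/-- with `A_n := {x : u_n(x;A) = 1}` and `A_∞ := ⋂_n A_n`, one has
`A_∞ = {x : u(x;A) = 1}`, `A_∞` is absorbing, and every absorbing measurable subset of `A`
is contained in `A_∞` (so `A_∞` is the largest absorbing subset of `A`).
In particular, if `m(A) < ∞` then `A` is simple. -/
theorem stmt6 (P : Kernel X X) [IsMarkovKernel P] (A : Set X) (hA : MeasurableSet A) :
    (⋂ n : ℕ, {x | uN P A n x = 1}) = {x | uFun P A x = 1} ∧
      Absorbing P (⋂ n : ℕ, {x | uN P A n x = 1}) ∧
      (∀ S ⊆ A, MeasurableSet S → Absorbing P S → S ⊆ ⋂ n : ℕ, {x | uN P A n x = 1}) ∧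
      ({k : ℕ | (⨆ x, uN P A k x) < 1}.Nonempty → Simple P A) := by
  have hmax : ∀ S ⊆ A, MeasurableSet S → Absorbing P S → S ⊆ ⋂ n : ℕ, {x | uN P A n x = 1} :=
    fun S hSA hS habs x hx => Set.mem_iInter.2 fun n =>
      uN_eq_one_of_absorbing P hSA hS habs n hx
  refine ⟨?_, fun x hx => ?_, hmax, ?_⟩
  · ext x
    simp [uFun_eq_one_iff]
  · have hmeas : MeasurableSet (⋂ n : ℕ, {x | uN P A n x = 1}) :=
      .iInter fun n => measurable_uN P hA n (measurableSet_singleton 1)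
    rw [← mem_ae_iff_prob_eq_one hmeas]
    filter_upwards [ae_all_iff.2 fun n =>
      ae_uN_eq_one_of_uN_succ_eq_one P hA (Set.mem_iInter.1 hx (n + 1))] with y hy
    exact Set.mem_iInter.2 hy
  · rintro ⟨k, hk : (⨆ x, uN P A k x) < 1⟩ S hSA hS habs
    refine Set.eq_empty_of_forall_notMem fun x hx => hk.not_ge ?_
    calc (1 : ℝ) = uN P A k x := (uN_eq_one_of_absorbing P hSA hS habs k hx).symm
      _ ≤ ⨆ x, uN P A k x :=
        le_ciSup (f := uN P A k) ⟨1, Set.forall_mem_range.2 fun y => (uN_mem_Icc P A k y).2⟩ x
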